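/- Let S be a connected analytic submanifold of ℝ^{n−1} and let P, Q ∈ ℝ[x₁,…,x_{n−1};x_n] have positive degrees p_n and q_n in x_n respectively. Assume P and Q never nullify on S and that P is projectively delineable over S. If the resultant Res^{p_n,q_n}_{x_n}(P,Q) is not the zero polynomial and is order-invariant over S, then along each projective P-section over S, either H^{q_n}(Q) vanishes at every point of the section or it vanishes at no point of the section. -/

import Mathlib

noncomputable section

open Polynomial Finset

/-- The real projective line `ℝP¹`: the quotient of `ℝ² ∖ {0}` by proportionality. -/
abbrev RP1 : Type := Projectivization ℝ (Fin 2 → ℝ)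

/-- The quotient topology on the real projective line. -/
instance : TopologicalSpace RP1 :=
  inferInstanceAs (TopologicalSpace (Quotient (projectivizationSetoid ℝ (Fin 2 → ℝ))))

/-- Homogenization of a univariate real polynomial with respect to the degree `d`,
as a binary form (an element of `ℝ[x,y]`, homogeneous of degree `d` when `P.natDegree ≤ d`):
`H^d(P)(x,y) = ∑_{k=0}^d c_k x^k y^(d-k)`. -/
def homog (d : ℕ) (P : Polynomial ℝ) : MvPolynomial (Fin 2) ℝ :=
  ∑ k ∈ Finset.range (d + 1),
    MvPolynomial.C (P.coeff k) * MvPolynomial.X 0 ^ k * MvPolynomial.X 1 ^ (d - k)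

/-- The pull-back `ι_M^{*}` of a binary form `g` along the parametrized line
`ι_M : x ↦ M (x,1)ᵀ`, i.e. the univariate polynomial `g(m₁₁ x + m₁₂, m₂₁ x + m₂₂)`.
For `M = 1` this is the standard pull-back `ι^{*d} g = g(x, 1)`. -/
def pullM (M : Matrix (Fin 2) (Fin 2) ℝ) (g : MvPolynomial (Fin 2) ℝ) : Polynomial ℝ :=
  MvPolynomial.eval₂ Polynomial.C
    ![Polynomial.C (M 0 0) * Polynomial.X + Polynomial.C (M 0 1),
      Polynomial.C (M 1 0) * Polynomial.X + Polynomial.C (M 1 1)] g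

/-- Right composition `R_M g = g ∘ M` of a binary form with a linear map of `ℝ²`. -/
def compM (M : Matrix (Fin 2) (Fin 2) ℝ) (g : MvPolynomial (Fin 2) ℝ) : MvPolynomial (Fin 2) ℝ :=
  MvPolynomial.eval₂ MvPolynomial.C
    (fun i => ∑ j, MvPolynomial.C (M i j) * MvPolynomial.X j) g

/-- The operator `A^{*d} P = ι_A^{*d} (H^d P)`, i.e.
`A^{*d}P(x) = ∑_{k=0}^d c_k (a₁₁x+a₁₂)^k (a₂₁x+a₂₂)^{d-k}` for `P = ∑ c_k x^k`. -/
def AstarU (d : ℕ) (M : Matrix (Fin 2) (Fin 2) ℝ) (P : Polynomial ℝ) : Polynomial ℝ :=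
  pullM M (homog d P)

/-- The Sylvester matrix of `P` and `Q` with respect to the fixed degrees `p` and `q`
(padding with zero coefficients as if `deg P = p` and `deg Q = q`). -/
def sylvester {R : Type*} [CommRing R] (p q : ℕ) (P Q : Polynomial R) :
    Matrix (Fin (p + q)) (Fin (p + q)) R := fun i j =>
  if (i : ℕ) < q then
    (if (i : ℕ) ≤ (j : ℕ) ∧ (j : ℕ) ≤ (i : ℕ) + p then P.coeff (p + (i : ℕ) - (j : ℕ)) else 0)
  else
    (if (i : ℕ) - q ≤ (j : ℕ) ∧ (j : ℕ) ≤ (i : ℕ) then Q.coeff (q + ((i : ℕ) - q) - (j : ℕ)) else 0)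

/-- The resultant `Res^{p,q}(P,Q)` with respect to the fixed degrees `p` and `q`:
the determinant of the corresponding Sylvester matrix. -/
def resFixed {R : Type*} [CommRing R] (p q : ℕ) (P Q : Polynomial R) : R :=
  (sylvester p q P Q).det

/-- The discriminant `Disc^p(P)` of `P` with respect to the fixed degree `p`: the resultant
(with respect to degrees `(p-1, p-1)`) of the pull-backs of the two partial derivatives
`F_x`, `F_y` of the binary form `F = H^p(P)`; these pull-backs are `P'` and `p·P − x·P'`. -/
def discFixed {R : Type*} [CommRing R] (p : ℕ) (P : Polynomial R) : R :=
  (-1) ^ (p * (p - 1) / 2) *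
    resFixed (p - 1) (p - 1) (Polynomial.derivative P)
      (Polynomial.C (p : R) * P - Polynomial.X * Polynomial.derivative P)

/-- Evaluation `E_x` of a polynomial in `x₁,…,x_m;x_n` at `x ∈ ℝ^m` in its first `m`
variables, giving a univariate real polynomial in `x_n`. -/
def evalP {m : ℕ} (P : Polynomial (MvPolynomial (Fin m) ℝ)) (x : Fin m → ℝ) : Polynomial ℝ :=
  P.map (MvPolynomial.eval x : MvPolynomial (Fin m) ℝ →+* ℝ)

/-- The operator `A^{*d}` acting on the last variable of a polynomial in `x₁,…,x_m;x_n`: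
`A^{*d}P(x,x_n) = ∑_{k=0}^d c_k(x) (a₁₁x_n+a₁₂)^k (a₂₁x_n+a₂₂)^{d-k}`. -/
def AstarPoly {m : ℕ} (d : ℕ) (M : Matrix (Fin 2) (Fin 2) ℝ)
    (P : Polynomial (MvPolynomial (Fin m) ℝ)) : Polynomial (MvPolynomial (Fin m) ℝ) :=
  ∑ k ∈ Finset.range (d + 1),
    Polynomial.C (P.coeff k) *
      (Polynomial.C (MvPolynomial.C (M 0 0)) * Polynomial.X
        + Polynomial.C (MvPolynomial.C (M 0 1))) ^ k *
      (Polynomial.C (MvPolynomial.C (M 1 0)) * Polynomial.X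
        + Polynomial.C (MvPolynomial.C (M 1 1))) ^ (d - k)

/-- The order of a (polynomial) function at a point: the smallest `k` such that some
partial derivative of total order `k` does not vanish at the point, i.e. the smallest `k`
with `iteratedFDeriv ℝ k f v ≠ 0`; it is `⊤` if all derivatives vanish. -/
def ordAt {E : Type*} [NormedAddCommGroup E] [NormedSpace ℝ E] (f : E → ℝ) (v : E) : ℕ∞ :=
  sInf {k : ℕ∞ | ∃ n : ℕ, k = n ∧ iteratedFDeriv ℝ n f v ≠ 0}

/-- A function is order-invariant on a set if it has the same order at every point of the set. -/
def OrderInvariantOn {E : Type*} [NormedAddCommGroup E] [NormedSpace ℝ E]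
    (f : E → ℝ) (S : Set E) : Prop :=
  ∀ x ∈ S, ∀ y ∈ S, ordAt f x = ordAt f y

/-- `(v 0 : v 1)` is a projective root of the binary form `g` of multiplicity (exactly) `mult`:
in the factorization of `g`, the linear form vanishing on the line through `v` occurs with
exponent `mult`. -/
def HasProjRootOfMult (g : MvPolynomial (Fin 2) ℝ) (v : Fin 2 → ℝ) (mult : ℕ) : Prop :=
  ∃ h : MvPolynomial (Fin 2) ℝ,
    g = (MvPolynomial.C (v 1) * MvPolynomial.X 0 - MvPolynomial.C (v 0) * MvPolynomial.X 1) ^ mult * h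
      ∧ MvPolynomial.eval v h ≠ 0

/-- The projective zero set `Z_{ℝP¹}(P,S)` of `P` over `S`, with respect to the degree `d`
in the last variable: the set of `(x, (x_n : y))` with `x ∈ S` and `H^d(P)(x,(x_n,y)) = 0`. -/
def ZProj {m : ℕ} (d : ℕ) (P : Polynomial (MvPolynomial (Fin m) ℝ)) (S : Set (Fin m → ℝ)) :
    Set ((Fin m → ℝ) × RP1) :=
  {p | p.1 ∈ S ∧ ∃ (v : Fin 2 → ℝ) (hv : v ≠ 0),
    Projectivization.mk ℝ v hv = p.2 ∧ MvPolynomial.eval v (homog d (evalP P p.1)) = 0}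

/-- `θ` is a (finite) system of real root functions for `P` on `S`: continuous functions with
pairwise disjoint graphs whose union is `Z_ℝ(P,S)`, each of constant positive multiplicity. -/
def IsRealRootFunctions {m : ℕ} (P : Polynomial (MvPolynomial (Fin m) ℝ)) (S : Set (Fin m → ℝ))
    {k : ℕ} (θ : Fin k → (Fin m → ℝ) → ℝ) : Prop :=
  (∀ l, ContinuousOn (θ l) S) ∧
  (∀ x ∈ S, ∀ l l' : Fin k, l ≠ l' → θ l x ≠ θ l' x) ∧
  (∀ x ∈ S, ∀ t : ℝ, (evalP P x).eval t = 0 ↔ ∃ l, θ l x = t) ∧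
  (∀ l : Fin k, ∃ mult : ℕ, 0 < mult ∧ ∀ x ∈ S, (evalP P x).rootMultiplicity (θ l x) = mult)

/-- `P` is delineable on `S`. -/
def Delineable {m : ℕ} (P : Polynomial (MvPolynomial (Fin m) ℝ)) (S : Set (Fin m → ℝ)) : Prop :=
  ∃ (k : ℕ) (θ : Fin k → (Fin m → ℝ) → ℝ), IsRealRootFunctions P S θ

/-- `θ` is a (finite) system of projective root functions for `P` on `S` with respect to the
degree `d` in the last variable: continuous functions into `ℝP¹` with pairwise disjoint graphs
whose union is `Z_{ℝP¹}(P,S)`, each of constant positive multiplicity. -/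
def IsProjRootFunctions {m : ℕ} (d : ℕ) (P : Polynomial (MvPolynomial (Fin m) ℝ))
    (S : Set (Fin m → ℝ)) {k : ℕ} (θ : Fin k → (Fin m → ℝ) → RP1) : Prop :=
  (∀ l, ContinuousOn (θ l) S) ∧
  (∀ x ∈ S, ∀ l l' : Fin k, l ≠ l' → θ l x ≠ θ l' x) ∧
  (∀ x ∈ S, ∀ (v : Fin 2 → ℝ) (hv : v ≠ 0),
    (MvPolynomial.eval v (homog d (evalP P x)) = 0 ↔ ∃ l, θ l x = Projectivization.mk ℝ v hv)) ∧
  (∀ l : Fin k, ∃ mult : ℕ, 0 < mult ∧ ∀ x ∈ S, ∀ (v : Fin 2 → ℝ) (hv : v ≠ 0),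
    θ l x = Projectivization.mk ℝ v hv → HasProjRootOfMult (homog d (evalP P x)) v mult)

/-- `P` is projectively delineable on `S` (with respect to the degree `d` in the last variable). -/
def ProjDelineable {m : ℕ} (d : ℕ) (P : Polynomial (MvPolynomial (Fin m) ℝ))
    (S : Set (Fin m → ℝ)) : Prop :=
  ∃ (k : ℕ) (θ : Fin k → (Fin m → ℝ) → RP1), IsProjRootFunctions d P S θ

/-- `S` is an analytic submanifold of `ℝ^m`: around each of its points, in suitable
real-analytic coordinates, `S` is an open piece of a linear subspace. -/
def IsAnalyticSubmanifold {m : ℕ} (S : Set (Fin m → ℝ)) : Prop :=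
  ∀ s ∈ S, ∃ (U V : Set (Fin m → ℝ)) (φ ψ : (Fin m → ℝ) → (Fin m → ℝ))
      (L : Submodule ℝ (Fin m → ℝ)),
    IsOpen U ∧ IsOpen V ∧ s ∈ U ∧
    AnalyticOnNhd ℝ φ U ∧ AnalyticOnNhd ℝ ψ V ∧
    Set.MapsTo φ U V ∧ Set.MapsTo ψ V U ∧
    Set.EqOn (ψ ∘ φ) id U ∧ Set.EqOn (φ ∘ ψ) id V ∧
    φ '' (U ∩ S) = V ∩ (L : Set (Fin m → ℝ))

end

section PartA
open Filter Topology Set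
open scoped ContDiff

variable {E : Type*} [NormedAddCommGroup E] [NormedSpace ℝ E]

theorem aux_analytic_line {F : E → ℝ} {x : E} (hF : AnalyticAt ℝ F x) (h : E) :
    AnalyticAt ℝ (fun t : ℝ => F (x + t • h)) 0 := by
  have h1 : AnalyticAt ℝ (fun t : ℝ => x + t • h) 0 := by fun_prop
  have h2 : AnalyticAt ℝ F ((fun t : ℝ => x + t • h) 0) := by simpa using hF
  exact AnalyticAt.comp (g := F) h2 h1

theorem aux_line {F : E → ℝ} {x : E} (hF : AnalyticAt ℝ F x) (h : E) (j : ℕ) :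
    iteratedDeriv j (fun t : ℝ => F (x + t • h)) 0 = iteratedFDeriv ℝ j F x (fun _ => h) := by
  obtain ⟨s, hs, hso, hxs⟩ := eventually_nhds_iff.1 hF.eventually_analyticAt
  let g : ℝ →L[ℝ] E := ContinuousLinearMap.toSpanSingleton ℝ h
  let s' : Set E := (fun y => x + y) ⁻¹' s
  have hs'o : IsOpen s' := hso.preimage (by fun_prop)
  have h0 : g 0 ∈ s' := by simpa [s', g] using hxs
  have hcd : ContDiffOn ℝ ω (fun y => F (x + y)) s' := by
    intro y hy
    apply ContDiffAt.contDiffWithinAt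
    have h2 : AnalyticAt ℝ F (x + y) := hs _ hy
    have h1 : AnalyticAt ℝ (fun y => x + y) y := by fun_prop
    exact (AnalyticAt.comp (g := F) h2 h1).contDiffAt
  have hpo : IsOpen (g ⁻¹' s') := hs'o.preimage g.continuous
  have key := g.iteratedFDerivWithin_comp_right hcd hs'o.uniqueDiffOn hpo.uniqueDiffOn h0
    (i := j) le_top
  rw [iteratedFDerivWithin_of_isOpen j hpo h0, iteratedFDerivWithin_of_isOpen j hs'o h0] at key
  rw [iteratedDeriv_eq_iteratedFDeriv]
  have : (fun t : ℝ => F (x + t • h)) = (fun y => F (x + y)) ∘ g := by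
    ext t; simp [g]
  rw [this, key, iteratedFDeriv_comp_add_left]
  simp [g]

theorem aux_polar {F : E → ℝ} {x : E} (hF : AnalyticAt ℝ F x) (n : ℕ)
    (h0 : ∀ h, iteratedFDeriv ℝ n F x (fun _ => h) = 0) : iteratedFDeriv ℝ n F x = 0 := by
  classical
  let q : FormalMultilinearSeries ℝ E ℝ :=
    fun j => if hj : j = n then hj ▸ iteratedFDeriv ℝ n F x else 0
  have hqn : q n = iteratedFDeriv ℝ n F x := by simp [q]
  have hq0 : ∀ j, j ≠ n → q j = 0 := fun j hj => by simp [q, hj]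
  have hq : HasFPowerSeriesOnBall (fun _ : E => (0 : ℝ)) q 0 ⊤ := by
    refine ⟨?_, by simp, ?_⟩
    · rw [q.radius_eq_top_of_forall_image_add_eq_zero (n + 1)]
      intro m; exact hq0 _ (by omega)
    · intro y _
      have : (fun j => (q j) fun _ => y) = fun _ => 0 := by
        ext j
        by_cases hj : j = n
        · subst hj; rw [hqn]; exact h0 y
        · rw [hq0 j hj]; simp
      rw [this]; exact hasSum_zero
  ext v
  have h1 := hq.iteratedFDeriv_eq_sum_of_completeSpace v
  have h2 : ∀ σ : Equiv.Perm (Fin n), q n (fun i => v (σ i)) = iteratedFDeriv ℝ n F x v := by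
    intro σ
    rw [hqn]
    exact (hF.contDiffAt (n := ω)).iteratedFDeriv_comp_perm v σ
  simp only [h2] at h1
  have h3 : iteratedFDeriv ℝ n (fun _ : E => (0 : ℝ)) 0 = 0 := by simp
  rw [h3] at h1
  simp [Fintype.card_perm, Nat.factorial_ne_zero] at h1
  simpa using h1

theorem aux_order {r f g : E → ℝ} {p : E} (hr : AnalyticAt ℝ r p) (hf : AnalyticAt ℝ f p)
    (hg : AnalyticAt ℝ g p) (hfg : r =ᶠ[𝓝 p] f * g) (hfin : ∃ n, iteratedFDeriv ℝ n r p ≠ 0)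
    (hfp : f p = 0) (S : Set E) (hpS : p ∈ S) (hS : OrderInvariantOn r S) :
    ∀ᶠ x in 𝓝[S] p, f x = 0 := by
  classical
  let k := Nat.find hfin
  have hk : iteratedFDeriv ℝ k r p ≠ 0 := Nat.find_spec hfin
  have hordp : ordAt r p = k := by
    apply le_antisymm
    · exact sInf_le ⟨k, rfl, hk⟩
    · apply le_sInf
      rintro _ ⟨n, rfl, hn⟩
      exact_mod_cast Nat.find_min' hfin hn
  have hlow : ∀ x ∈ S, ∀ j < k, iteratedFDeriv ℝ j r x = 0 := by
    intro x hx j hj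
    by_contra hne
    have h1 : ordAt r x ≤ j := sInf_le ⟨j, rfl, hne⟩
    rw [hS x hx p hpS, hordp] at h1
    have : k ≤ j := by exact_mod_cast h1
    omega
  obtain ⟨h, hh⟩ : ∃ h, iteratedFDeriv ℝ k r p (fun _ => h) ≠ 0 := by
    by_contra hcon
    push Not at hcon
    exact hk (aux_polar hr k hcon)
  have hmul : ∀ᶠ x in 𝓝 p, analyticOrderAt (fun t : ℝ => r (x + t • h)) 0 =
      analyticOrderAt (fun t : ℝ => f (x + t • h)) 0 +
      analyticOrderAt (fun t : ℝ => g (x + t • h)) 0 := by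
    filter_upwards [hf.eventually_analyticAt, hg.eventually_analyticAt,
      hfg.eventually_nhds] with x hfx hgx hx
    rw [← analyticOrderAt_mul (aux_analytic_line hfx h) (aux_analytic_line hgx h)]
    apply analyticOrderAt_congr
    have hc : Tendsto (fun t : ℝ => x + t • h) (𝓝 0) (𝓝 x) := by
      have : ContinuousAt (fun t : ℝ => x + t • h) 0 := by fun_prop
      simpa [ContinuousAt] using this
    exact hc.eventually hx
  have hrk : analyticOrderAt (fun t : ℝ => r (p + t • h)) 0 = k := by
    rw [analyticOrderAt_eq_nat_iff_iteratedDeriv_eq_zero (aux_analytic_line hr h)]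
    refine ⟨fun j hj => ?_, ?_⟩
    · rw [aux_line hr, hlow p hpS j hj]; rfl
    · rw [aux_line hr]; exact hh
  have hsum := hmul.self_of_nhds
  rw [hrk] at hsum
  obtain ⟨a, ha⟩ : ∃ a : ℕ, analyticOrderAt (fun t : ℝ => f (p + t • h)) 0 = a := by
    have : analyticOrderAt (fun t : ℝ => f (p + t • h)) 0 ≠ ⊤ := by
      intro h; rw [h] at hsum; simp at hsum
    exact ⟨_, (ENat.natCast_toNat this).symm⟩
  obtain ⟨b, hb⟩ : ∃ a : ℕ, analyticOrderAt (fun t : ℝ => g (p + t • h)) 0 = a := by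
    have : analyticOrderAt (fun t : ℝ => g (p + t • h)) 0 ≠ ⊤ := by
      intro h; rw [h] at hsum; simp at hsum
    exact ⟨_, (ENat.natCast_toNat this).symm⟩
  rw [ha, hb] at hsum
  have hsum' : k = a + b := by exact_mod_cast hsum
  have ha0 : 0 < a := by
    rcases Nat.eq_zero_or_pos a with h0 | h0
    · rw [h0] at ha
      have := (aux_analytic_line hf h).analyticOrderAt_eq_zero.1 (by simpa using ha)
      simp [hfp] at this
    · exact h0
  have semi : ∀ (F : E → ℝ) (c : ℕ), AnalyticAt ℝ F p →
      analyticOrderAt (fun t : ℝ => F (p + t • h)) 0 = c →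
      ∀ᶠ x in 𝓝 p, analyticOrderAt (fun t : ℝ => F (x + t • h)) 0 ≤ c := by
    intro F c hF hc
    have h1 := ((analyticOrderAt_eq_nat_iff_iteratedDeriv_eq_zero (aux_analytic_line hF h)).1 hc).2
    rw [aux_line hF] at h1
    have hcont : ContinuousAt (fun x => iteratedFDeriv ℝ c F x (fun _ => h)) p := by
      have := (hF.contDiffAt (n := ω)).continuousAt_iteratedFDeriv (k := c) le_top
      exact (ContinuousMultilinearMap.apply ℝ (fun _ : Fin c => E) ℝ
        (fun _ => h)).continuous.continuousAt.comp this
    filter_upwards [hcont.eventually_ne h1, hF.eventually_analyticAt] with x hx hFx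
    by_contra hlt
    have h2 : ((c + 1 : ℕ) : ℕ∞) ≤ analyticOrderAt (fun t : ℝ => F (x + t • h)) 0 := by
      push_cast
      exact Order.add_one_le_of_lt (not_le.1 hlt)
    rw [natCast_le_analyticOrderAt_iff_iteratedDeriv_eq_zero (aux_analytic_line hFx h)] at h2
    have h3 := h2 c (by omega)
    rw [aux_line hFx] at h3
    exact hx h3
  have hxs : ∀ᶠ x in 𝓝[S] p, x ∈ S := self_mem_nhdsWithin
  filter_upwards [hxs, mem_nhdsWithin_of_mem_nhds (semi f a hf ha),
    mem_nhdsWithin_of_mem_nhds (semi g b hg hb), mem_nhdsWithin_of_mem_nhds hmul,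
    mem_nhdsWithin_of_mem_nhds hr.eventually_analyticAt,
    mem_nhdsWithin_of_mem_nhds hf.eventually_analyticAt] with x hx hxa hxb hxm hxr hxf
  have hge : (k : ℕ∞) ≤ analyticOrderAt (fun t : ℝ => r (x + t • h)) 0 := by
    rw [natCast_le_analyticOrderAt_iff_iteratedDeriv_eq_zero (aux_analytic_line hxr h)]
    intro j hj
    rw [aux_line hxr, hlow x hx j hj]; rfl
  rw [hxm] at hge
  by_contra hne
  have h0 : analyticOrderAt (fun t : ℝ => f (x + t • h)) 0 = 0 :=
    (aux_analytic_line hxf h).analyticOrderAt_eq_zero.2 (by simpa using hne)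
  rw [h0, zero_add] at hge
  have : (k : ℕ∞) ≤ b := hge.trans hxb
  have : k ≤ b := by exact_mod_cast this
  omega

theorem aux_fin {m : ℕ} (r : MvPolynomial (Fin m) ℝ) (hr : r ≠ 0) (p : Fin m → ℝ) :
    ∃ n, iteratedFDeriv ℝ n (fun x => MvPolynomial.eval x r) p ≠ 0 := by
  have han : ∀ x, AnalyticAt ℝ (fun x => MvPolynomial.eval x r) x := fun x =>
    AnalyticOnNhd.eval_mvPolynomial r x (Set.mem_univ x)
  by_contra hcon
  push Not at hcon
  apply hr
  apply MvPolynomial.funext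
  intro y
  have hl : AnalyticOnNhd ℝ (fun t : ℝ => MvPolynomial.eval (p + t • (y - p)) r) univ := by
    intro t _
    have h1 : AnalyticAt ℝ (fun t : ℝ => p + t • (y - p)) t := by fun_prop
    exact AnalyticAt.comp (g := fun x => MvPolynomial.eval x r) (han _) h1
  have htop : analyticOrderAt (fun t : ℝ => MvPolynomial.eval (p + t • (y - p)) r) 0 = ⊤ := by
    rw [ENat.eq_top_iff_forall_ge]
    intro n
    rw [natCast_le_analyticOrderAt_iff_iteratedDeriv_eq_zero (hl 0 (mem_univ _))]
    intro i _
    rw [aux_line (F := fun x => MvPolynomial.eval x r) (han p), hcon i]; rfl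
  rw [analyticOrderAt_eq_top] at htop
  have := hl.eqOn_zero_of_preconnected_of_eventuallyEq_zero isPreconnected_univ (mem_univ 0) htop
    (mem_univ 1)
  simpa using this
end PartA
section PartB
open Polynomial

theorem aux_resFixed {R : Type*} [CommRing R] (p q : ℕ) (P Q : R[X]) :
    resFixed p q P Q = Polynomial.resultant P Q p q := by
  have : _root_.sylvester p q P Q = ((Polynomial.sylvester P Q p q).submatrix Fin.revPerm Fin.revPerm).transpose := by
    ext i j
    rw [Matrix.transpose_apply, Matrix.submatrix_apply]
    by_cases hi : (i : ℕ) < q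
    · have hri : Fin.revPerm i = Fin.natAdd p (⟨q - 1 - i, by omega⟩ : Fin q) := by
        ext; simp [Fin.val_rev]; omega
      rw [hri]
      simp only [_root_.sylvester, Polynomial.sylvester, Matrix.of_apply, Fin.addCases_right, hi,
        if_true, Fin.revPerm_apply, Fin.val_rev, Set.mem_Icc]
      have hj := j.2
      split_ifs with h1 h2 h2
      · congr 1; omega
      · omega
      · omega
      · rfl
    · have hi2 := i.2
      have hri : Fin.revPerm i = Fin.castAdd q (⟨p + q - 1 - i, by omega⟩ : Fin p) := by
        ext; simp [Fin.val_rev]; omega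
      rw [hri]
      simp only [_root_.sylvester, Polynomial.sylvester, Matrix.of_apply, Fin.addCases_left, hi,
        if_false, Fin.revPerm_apply, Fin.val_rev, Set.mem_Icc]
      have hj := j.2
      split_ifs with h1 h2 h2
      · congr 1; omega
      · omega
      · omega
      · rfl
  rw [resFixed, this, Matrix.det_transpose, Matrix.det_submatrix_equiv_self, Polynomial.resultant]

theorem aux_resultant_mul (A B g : ℝ[X]) (m b n : ℕ) (hA : A.natDegree ≤ m) (hB : B.natDegree ≤ b)
    (hg : g.natDegree ≤ n) :
    resultant (A * B) g (m + b) n = resultant A g m n * resultant B g b n := by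
  obtain ⟨k, rfl⟩ := Nat.exists_eq_add_of_le hA
  obtain ⟨l, rfl⟩ := Nat.exists_eq_add_of_le hB
  rw [show A.natDegree + k + (B.natDegree + l) = A.natDegree + B.natDegree + (k + l) by ring,
    resultant_add_left_deg _ _ _ _ _ natDegree_mul_le, resultant_add_left_deg _ _ _ _ _ le_rfl,
    resultant_add_left_deg _ _ _ _ _ le_rfl, resultant_mul_left _ _ _ _ hg]
  ring

theorem aux_eval_homog (d : ℕ) (P : ℝ[X]) (v : Fin 2 → ℝ) :
    MvPolynomial.eval v (homog d P) = ∑ k ∈ Finset.range (d + 1), P.coeff k * v 0 ^ k * v 1 ^ (d - k) := by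
  simp [homog]

theorem aux_eval_homog_ne (d : ℕ) (P : ℝ[X]) (hP : P.natDegree ≤ d) (v : Fin 2 → ℝ) (hv : v 1 ≠ 0) :
    MvPolynomial.eval v (homog d P) = v 1 ^ d * P.eval (v 0 / v 1) := by
  rw [aux_eval_homog, eval_eq_sum_range' (Nat.lt_succ_of_le hP), Finset.mul_sum]
  apply Finset.sum_congr rfl
  intro k hk
  have : k ≤ d := by simpa [Nat.lt_succ_iff] using hk
  rw [div_pow, ← Nat.sub_add_cancel this, pow_add]
  simp
  field_simp

theorem aux_eval_homog_zero (d : ℕ) (P : ℝ[X]) (v : Fin 2 → ℝ) (hv : v 1 = 0) :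
    MvPolynomial.eval v (homog d P) = P.coeff d * v 0 ^ d := by
  rw [aux_eval_homog, Finset.sum_range_succ, Finset.sum_eq_zero]
  · simp
  · intro k hk
    have : k < d := by simpa using hk
    rw [hv, zero_pow (by omega), mul_zero]

theorem aux_v0 {v : Fin 2 → ℝ} (hv : v ≠ 0) (h1 : v 1 = 0) : v 0 ≠ 0 := by
  intro h0
  apply hv
  ext i
  fin_cases i
  · exact h0
  · exact h1

theorem aux_res_pow (c : ℝ) (hc : c ≠ 0) (v : Fin 2 → ℝ) (hv : v ≠ 0) (g : ℝ[X]) (m n : ℕ)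
    (hm : 0 < m) (hg : g.natDegree ≤ n) :
    resultant (C c * (C (v 1) * X - C (v 0)) ^ m) g m n = 0 ↔
      MvPolynomial.eval v (homog n g) = 0 := by
  by_cases h1 : v 1 = 0
  · have h0 := aux_v0 hv h1
    have : C c * (C (v 1) * X - C (v 0)) ^ m = C (c * (- v 0) ^ m) := by
      simp [h1]
    rw [this, resultant_C_left, aux_eval_homog_zero _ _ _ h1]
    simp [hc, h0, hm.ne']
  · have : C c * (C (v 1) * X - C (v 0)) ^ m = C (c * v 1 ^ m) * (X - C (v 0 / v 1)) ^ m := by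
      rw [C_mul, mul_assoc, C_pow, ← mul_pow, mul_sub, ← C_mul, mul_div_cancel₀ _ h1]
    rw [this, resultant_C_mul_left, resultant_X_sub_C_pow_left _ _ _ _ hg, aux_eval_homog_ne _ _ hg _ h1]
    simp [hc, h1, hm.ne']

theorem aux_hom_homog (d : ℕ) (P : ℝ[X]) : (homog d P).IsHomogeneous d := by
  apply MvPolynomial.IsHomogeneous.sum
  intro k hk
  have hk : k ≤ d := by simpa [Nat.lt_succ_iff] using hk
  have := ((MvPolynomial.isHomogeneous_C (Fin 2) (P.coeff k)).mul
    (MvPolynomial.isHomogeneous_X_pow (R := ℝ) (0 : Fin 2) k)).mul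
    (MvPolynomial.isHomogeneous_X_pow (R := ℝ) (1 : Fin 2) (d - k))
  convert this using 1
  omega

/-- dehomogenization -/
noncomputable def dehom : MvPolynomial (Fin 2) ℝ →ₐ[ℝ] ℝ[X] := MvPolynomial.aeval ![X, 1]

theorem aux_dehom_homog (d : ℕ) (P : ℝ[X]) (hP : P.natDegree ≤ d) : dehom (homog d P) = P := by
  conv_rhs => rw [P.as_sum_range' (d + 1) (Nat.lt_succ_of_le hP)]
  simp [dehom, homog, C_mul_X_pow_eq_monomial]

theorem aux_dehom_lin (v : Fin 2 → ℝ) :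
    dehom (MvPolynomial.C (v 1) * MvPolynomial.X 0 - MvPolynomial.C (v 0) * MvPolynomial.X 1)
      = C (v 1) * X - C (v 0) := by
  simp [dehom]

theorem aux_deg_dehom (d : ℕ) (g : MvPolynomial (Fin 2) ℝ) (hg : g.IsHomogeneous d) :
    (dehom g).natDegree ≤ d ∧ ∀ v, MvPolynomial.eval v (homog d (dehom g)) = MvPolynomial.eval v g := by
  have key : ∃ P : ℝ[X], P.natDegree ≤ d ∧ homog d P = g := by
    refine ⟨∑ k ∈ Finset.range (d + 1), C (g.coeff (Finsupp.single 0 k + Finsupp.single 1 (d - k))) * X ^ k, ?_, ?_⟩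
    · apply natDegree_sum_le_of_forall_le
      intro k hk
      have hk : k ≤ d := by simpa [Nat.lt_succ_iff] using hk
      exact (natDegree_C_mul_X_pow_le _ _).trans hk
    · have hc : ∀ k ∈ Finset.range (d + 1), (∑ k ∈ Finset.range (d + 1), C (g.coeff (Finsupp.single 0 k + Finsupp.single 1 (d - k))) * X ^ k).coeff k = g.coeff (Finsupp.single 0 k + Finsupp.single 1 (d - k)) := by
        intro k hk
        rw [finsetSum_coeff]
        simp only [coeff_C_mul_X_pow]
        rw [Finset.sum_eq_single k]
        · simp
        · intro b _ hb; simp [hb.symm]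
        · intro h; exact absurd hk h
      rw [homog, Finset.sum_congr rfl (fun k hk => by rw [hc k hk])]
      have hmon : ∀ k (c : ℝ), MvPolynomial.C c * MvPolynomial.X (0 : Fin 2) ^ k * MvPolynomial.X (1 : Fin 2) ^ (d - k) = MvPolynomial.monomial (Finsupp.single 0 k + Finsupp.single 1 (d - k)) c := by
        intro k c
        rw [MvPolynomial.X_pow_eq_monomial, MvPolynomial.X_pow_eq_monomial, MvPolynomial.C_mul_monomial,
          MvPolynomial.monomial_mul]
        simp
      simp only [hmon]
      ext e
      rw [MvPolynomial.coeff_sum]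
      simp only [MvPolynomial.coeff_monomial]
      by_cases he : e 0 + e 1 = d
      · have he' : e = Finsupp.single 0 (e 0) + Finsupp.single 1 (d - e 0) := by
          ext i; fin_cases i
          · simp
          · simp; omega
        rw [Finset.sum_eq_single (e 0)]
        · rw [if_pos he'.symm, ← he']
        · intro b _ hb
          rw [if_neg]
          intro h
          apply hb
          rw [← h]; simp
        · intro h; exfalso; apply h; simp; omega
      · rw [Finset.sum_eq_zero, hg.coeff_eq_zero]
        · rw [Finsupp.degree_eq_sum, Fin.sum_univ_two]; exact he
        · intro k hk
          have hk : k ≤ d := by simpa [Nat.lt_succ_iff] using hk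
          rw [if_neg]
          intro h
          apply he
          rw [← h]; simp; omega
  obtain ⟨P, hP, rfl⟩ := key
  rw [aux_dehom_homog d P hP]
  exact ⟨hP, fun _ => rfl⟩

theorem aux_hom_factor {σ : Type*} (d a : ℕ) (l h g : MvPolynomial σ ℝ) (hl : l.IsHomogeneous a)
    (hg : g.IsHomogeneous d) (e : g = l * h) (hg0 : g ≠ 0) : a ≤ d ∧ h.IsHomogeneous (d - a) := by
  have hl0 : l ≠ 0 := by rintro rfl; simp at e; exact hg0 e
  have hh0 : h ≠ 0 := by rintro rfl; simp at e; exact hg0 e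
  have hcomp : ∀ i, h.homogeneousComponent i ≠ 0 → a + i = d := by
    intro i hi
    by_contra hne
    have hz : MvPolynomial.homogeneousComponent (a + i) g = l * MvPolynomial.homogeneousComponent i h := by
      rw [e]
      conv_lhs => rw [← h.sum_homogeneousComponent, Finset.mul_sum, map_sum]
      have hterm : ∀ j, MvPolynomial.homogeneousComponent (a + i) (l * MvPolynomial.homogeneousComponent j h)
          = if j = i then l * MvPolynomial.homogeneousComponent i h else 0 := by
        intro j
        rw [MvPolynomial.homogeneousComponent_of_mem (hl.mul (h.homogeneousComponent_isHomogeneous j))]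
        by_cases hji : j = i
        · simp [hji]
        · rw [if_neg (by omega), if_neg hji]
      simp only [hterm]
      rw [Finset.sum_ite_eq', if_pos]
      rw [Finset.mem_range]
      by_contra hlt
      exact hi (MvPolynomial.homogeneousComponent_eq_zero _ _ (by omega))
    rw [MvPolynomial.homogeneousComponent_of_mem hg, if_neg (fun h => hne (by omega))] at hz
    exact (mul_ne_zero hl0 hi) hz.symm
  have hex : ∃ i, h.homogeneousComponent i ≠ 0 := by
    by_contra hcon
    push Not at hcon
    apply hh0
    rw [← h.sum_homogeneousComponent]
    exact Finset.sum_eq_zero fun i _ => hcon i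
  obtain ⟨i, hi⟩ := hex
  have hai := hcomp i hi
  refine ⟨by omega, ?_⟩
  have hdi : d - a = i := by omega
  rw [hdi]
  have : h = h.homogeneousComponent i := by
    conv_lhs => rw [← h.sum_homogeneousComponent]
    rw [Finset.sum_eq_single i]
    · intro j _ hj
      by_contra hne
      have := hcomp j hne
      omega
    · intro hn
      apply MvPolynomial.homogeneousComponent_eq_zero
      simpa using hn
  rw [this]
  exact h.homogeneousComponent_isHomogeneous i

theorem aux_root_struct (d mult : ℕ) (P : ℝ[X]) (hP : P.natDegree ≤ d) (hP0 : P ≠ 0) (v : Fin 2 → ℝ)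
    (hr : HasProjRootOfMult (homog d P) v mult) :
    mult ≤ d ∧ ∃ h : ℝ[X], h.natDegree ≤ d - mult ∧ P = (C (v 1) * X - C (v 0)) ^ mult * h ∧
      MvPolynomial.eval v (homog (d - mult) h) ≠ 0 := by
  obtain ⟨h, e, hne⟩ := hr
  have hg0 : homog d P ≠ 0 := by
    intro h0
    apply hP0
    rw [← aux_dehom_homog d P hP, h0, map_zero]
  have hlin : (MvPolynomial.C (v 1) * MvPolynomial.X 0 - MvPolynomial.C (v 0) * MvPolynomial.X 1 : MvPolynomial (Fin 2) ℝ).IsHomogeneous 1 :=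
    (MvPolynomial.isHomogeneous_C_mul_X _ _).sub (MvPolynomial.isHomogeneous_C_mul_X _ _)
  have hl := hlin.pow mult
  rw [one_mul] at hl
  obtain ⟨hle, hh⟩ := aux_hom_factor d mult _ h _ hl (aux_hom_homog d P) e hg0
  obtain ⟨h1, h2⟩ := aux_deg_dehom _ h hh
  refine ⟨hle, dehom h, h1, ?_, ?_⟩
  · rw [← aux_dehom_lin, ← map_pow, ← map_mul, ← e, aux_dehom_homog d P hP]
  · rw [h2]; exact hne

theorem aux_A_eq (m b : ℕ) (A B P h : ℝ[X]) (w : Fin 2 → ℝ) (hw : w ≠ 0)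
    (hA : A.natDegree ≤ m) (hB : B.natDegree ≤ b) (hP0 : P ≠ 0) (hPAB : P = A * B)
    (hPh : P = (C (w 1) * X - C (w 0)) ^ m * h) (hh : h.natDegree ≤ b)
    (hBw : MvPolynomial.eval w (homog b B) ≠ 0) :
    ∃ c : ℝ, c ≠ 0 ∧ A = C c * (C (w 1) * X - C (w 0)) ^ m := by
  have hA0 : A ≠ 0 := by rintro rfl; simp at hPAB; exact hP0 hPAB
  by_cases h1 : w 1 = 0
  · have h0 := aux_v0 hw h1
    rw [aux_eval_homog_zero _ _ _ h1] at hBw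
    have hBb : B.natDegree = b := natDegree_eq_of_le_of_coeff_ne_zero hB (left_ne_zero_of_mul hBw)
    have hB0 : B ≠ 0 := by rintro rfl; simp at hPAB; exact hP0 hPAB
    have hl : (C (w 1) * X - C (w 0)) ^ m = C ((-w 0) ^ m) := by simp [h1]
    have hPd : P.natDegree ≤ b := by
      rw [hPh, hl]; exact (natDegree_C_mul_le _ _).trans hh
    rw [hPAB, natDegree_mul hA0 hB0, hBb] at hPd
    have hAd : A = C (A.coeff 0) := eq_C_of_natDegree_eq_zero (by omega)
    have hw0 : (-w 0) ^ m ≠ 0 := pow_ne_zero _ (neg_ne_zero.2 h0)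
    refine ⟨A.coeff 0 / (-w 0) ^ m, ?_, ?_⟩
    · apply div_ne_zero _ hw0
      intro hz; rw [hz, C_0] at hAd; exact hA0 hAd
    · rw [hl, ← C_mul, div_mul_cancel₀ _ hw0]; exact hAd
  · rw [aux_eval_homog_ne _ _ hB _ h1] at hBw
    have hBr := right_ne_zero_of_mul hBw
    have hl : (C (w 1) * X - C (w 0)) ^ m = C (w 1 ^ m) * (X - C (w 0 / w 1)) ^ m := by
      rw [C_pow, ← mul_pow, mul_sub, ← C_mul, mul_div_cancel₀ _ h1]
    have hdvd : (X - C (w 0 / w 1)) ^ m ∣ A * B := by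
      rw [← hPAB, hPh, hl]
      exact ⟨C (w 1 ^ m) * h, by ring⟩
    have hcop : IsCoprime ((X - C (w 0 / w 1)) ^ m) B := by
      apply IsCoprime.pow_left
      rw [(irreducible_X_sub_C _).coprime_iff_not_dvd, dvd_iff_isRoot]
      exact hBr
    obtain ⟨q, hq⟩ := hcop.dvd_of_dvd_mul_right hdvd
    have hq0 : q ≠ 0 := by rintro rfl; simp at hq; exact hA0 hq
    have hqd : q.natDegree = 0 := by
      rw [hq, natDegree_mul (pow_ne_zero _ (X_sub_C_ne_zero _)) hq0, natDegree_pow, natDegree_X_sub_C] at hA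
      omega
    have hqc := eq_C_of_natDegree_eq_zero hqd
    have hw1 : w 1 ^ m ≠ 0 := pow_ne_zero _ h1
    refine ⟨q.coeff 0 / w 1 ^ m, ?_, ?_⟩
    · apply div_ne_zero _ hw1
      intro hz; rw [hz, C_0] at hqc; exact hq0 hqc
    · rw [hl, ← mul_assoc, ← C_mul, div_mul_cancel₀ _ hw1, ← hqc, hq]; ring

theorem aux_surj (m b : ℕ) (v : Fin 2 → ℝ) (hv : v ≠ 0) (h : ℝ[X]) (hh : h.natDegree ≤ b)
    (hne : MvPolynomial.eval v (homog b h) ≠ 0) (W : ℝ[X]) (hW : W.natDegree ≤ m + b) :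
    ∃ A B : ℝ[X], A.natDegree ≤ m ∧ B.natDegree ≤ b ∧ A * h + (C (v 1) * X - C (v 0)) ^ m * B = W := by
  by_cases h1 : v 1 = 0
  · have h0 := aux_v0 hv h1
    rw [aux_eval_homog_zero _ _ _ h1] at hne
    have hb : h.natDegree = b := natDegree_eq_of_le_of_coeff_ne_zero hh (left_ne_zero_of_mul hne)
    have hl : (C (v 1) * X - C (v 0)) ^ m = C ((-v 0) ^ m) := by simp [h1]
    have hv0 : (-v 0) ^ m ≠ 0 := pow_ne_zero _ (neg_ne_zero.2 h0)
    have hh0 : h ≠ 0 := by rintro rfl; simp at hne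
    refine ⟨W / h, C ((-v 0) ^ m)⁻¹ * (W % h), ?_, ?_, ?_⟩
    · by_cases hq : W / h = 0
      · simp [hq]
      have e1 : h * (W / h) = W - W % h := by
        have := EuclideanDomain.div_add_mod W h
        exact eq_sub_of_add_eq this
      have e2 : (W - W % h).natDegree ≤ m + b := by
        refine (natDegree_sub_le _ _).trans (max_le hW ?_)
        have := natDegree_le_natDegree (EuclideanDomain.mod_lt W hh0).le
        omega
      rw [← e1, natDegree_mul hh0 hq] at e2
      omega
    · refine (natDegree_C_mul_le _ _).trans ?_
      rw [← hb]
      exact natDegree_le_natDegree (EuclideanDomain.mod_lt W hh0).le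
    · rw [hl, ← mul_assoc, ← C_mul, mul_inv_cancel₀ hv0, C_1, one_mul, mul_comm]
      exact EuclideanDomain.div_add_mod W h
  · rw [aux_eval_homog_ne _ _ hh _ h1] at hne
    have hr := right_ne_zero_of_mul hne
    have hl : (C (v 1) * X - C (v 0)) ^ m = C (v 1 ^ m) * (X - C (v 0 / v 1)) ^ m := by
      rw [C_pow, ← mul_pow, mul_sub, ← C_mul, mul_div_cancel₀ _ h1]
    have hv1 : v 1 ^ m ≠ 0 := pow_ne_zero _ h1
    set L := (X - C (v 0 / v 1)) ^ m with hL
    have hcop : IsCoprime L h := by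
      apply IsCoprime.pow_left
      rw [(irreducible_X_sub_C _).coprime_iff_not_dvd, dvd_iff_isRoot]
      exact hr
    obtain ⟨s, t, hst⟩ := hcop
    have hLm : L.Monic := (monic_X_sub_C _).pow m
    have hLd : L.natDegree = m := by rw [hL, natDegree_pow, natDegree_X_sub_C, mul_one]
    have hAd : (W * t %ₘ L).natDegree ≤ m := by
      rw [← hLd]
      exact natDegree_le_natDegree (degree_modByMonic_lt _ hLm).le
    have heq : W - (W * t %ₘ L) * h = L * (W * s + (W * t /ₘ L) * h) := by
      have := modByMonic_add_div (W * t) L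
      have e2 : W * t %ₘ L = W * t - L * (W * t /ₘ L) := eq_sub_of_add_eq this
      calc W - (W * t %ₘ L) * h = W * (s * L + t * h) - (W * t %ₘ L) * h := by rw [hst, mul_one]
        _ = _ := by rw [e2]; ring
    refine ⟨W * t %ₘ L, C (v 1 ^ m)⁻¹ * (W * s + (W * t /ₘ L) * h), hAd, ?_, ?_⟩
    · refine (natDegree_C_mul_le _ _).trans ?_
      have hd : (W - (W * t %ₘ L) * h).natDegree ≤ m + b := by
        refine (natDegree_sub_le _ _).trans (max_le hW (natDegree_mul_le.trans ?_))
        omega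
      by_cases hq : W * s + (W * t /ₘ L) * h = 0
      · simp [hq]
      rw [heq, hLm.natDegree_mul' hq, hLd] at hd
      omega
    · rw [hl]
      have e3 : C (v 1 ^ m) * L * (C (v 1 ^ m)⁻¹ * (W * s + (W * t /ₘ L) * h)) =
          (C (v 1 ^ m) * C (v 1 ^ m)⁻¹) * (L * (W * s + (W * t /ₘ L) * h)) := by ring
      rw [e3, ← C_mul, mul_inv_cancel₀ hv1, C_1, one_mul, ← heq]
      ring
end PartB
section PartC
open Polynomial Filter Topology
open scoped ContDiff

theorem aux_factor (m b : ℕ) (A0 B0 : ℝ[X]) (hA0 : A0.natDegree ≤ m) (hB0 : B0.natDegree ≤ b)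
    (hsurj : ∀ W : ℝ[X], W.natDegree ≤ m + b →
      ∃ A B : ℝ[X], A.natDegree ≤ m ∧ B.natDegree ≤ b ∧ A * B0 + A0 * B = W) :
    ∃ (α : (Fin (m + b + 1) → ℝ) → (Fin (m + 1) → ℝ)) (β : (Fin (m + b + 1) → ℝ) → (Fin (b + 1) → ℝ)),
      AnalyticAt ℝ α (toFn (m + b + 1) (A0 * B0)) ∧ AnalyticAt ℝ β (toFn (m + b + 1) (A0 * B0)) ∧
      ofFn _ (α (toFn (m + b + 1) (A0 * B0))) = A0 ∧ ofFn _ (β (toFn (m + b + 1) (A0 * B0))) = B0 ∧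
      ∀ᶠ c in 𝓝 (toFn (m + b + 1) (A0 * B0)), ofFn _ (α c) * ofFn _ (β c) = ofFn _ c := by
  let μ : (Fin (m + 1) → ℝ) →ₗ[ℝ] (Fin (b + 1) → ℝ) →ₗ[ℝ] (Fin (m + b + 1) → ℝ) :=
    LinearMap.mk₂ ℝ (fun x y => toFn (m + b + 1) (ofFn (m + 1) x * ofFn (b + 1) y))
      (by intros; simp [add_mul]) (by intros; simp) (by intros; simp [mul_add]) (by intros; simp)
  have hμ : ∀ x y, μ x y = toFn (m + b + 1) (ofFn (m + 1) x * ofFn (b + 1) y) := fun _ _ => rfl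
  let μc : (Fin (m + 1) → ℝ) →L[ℝ] (Fin (b + 1) → ℝ) →L[ℝ] (Fin (m + b + 1) → ℝ) :=
    LinearMap.toContinuousLinearMap
      ((LinearMap.toContinuousLinearMap : _ ≃ₗ[ℝ] ((Fin (b + 1) → ℝ) →L[ℝ] (Fin (m + b + 1) → ℝ))).toLinearMap ∘ₗ μ)
  have hμc : ∀ x y, μc x y = μ x y := fun _ _ => rfl
  have ofto : ∀ (n : ℕ) (A : ℝ[X]), A.natDegree ≤ n → ofFn (n + 1) (toFn (n + 1) A) = A :=
    fun n A hA => ofFn_comp_toFn_eq_id_of_natDegree_lt (Nat.lt_succ_of_le hA)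
  let a0 := toFn (m + 1) A0
  let b0 := toFn (b + 1) B0
  let D : ((Fin (m + 1) → ℝ) × (Fin (b + 1) → ℝ)) →ₗ[ℝ] (Fin (m + b + 1) → ℝ) :=
    LinearMap.coprod (μ.flip b0) (μ a0)
  have hD : LinearMap.range D = ⊤ := by
    rw [LinearMap.range_eq_top]
    intro w
    obtain ⟨A, B, hA, hB, hAB⟩ := hsurj (ofFn (m + b + 1) w) (Nat.lt_succ_iff.1 (ofFn_natDegree_lt (by omega) w))
    refine ⟨(toFn _ A, toFn _ B), ?_⟩
    simp only [D, LinearMap.coprod_apply, LinearMap.flip_apply, hμ, a0, b0]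
    rw [ofto _ A hA, ofto _ B hB, ofto _ A0 hA0, ofto _ B0 hB0, ← map_add, hAB]
    exact toFn_comp_ofFn_eq_id (v := w)
  obtain ⟨T, hT⟩ := D.exists_rightInverse_of_surjective hD
  let T1 : (Fin (m + b + 1) → ℝ) →L[ℝ] (Fin (m + 1) → ℝ) := LinearMap.toContinuousLinearMap (LinearMap.fst ℝ _ _ ∘ₗ T)
  let T2 : (Fin (m + b + 1) → ℝ) →L[ℝ] (Fin (b + 1) → ℝ) := LinearMap.toContinuousLinearMap (LinearMap.snd ℝ _ _ ∘ₗ T)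
  have hT' : ∀ w, μ (T1 w) b0 + μ a0 (T2 w) = w := fun w => by
    have := LinearMap.congr_fun hT w
    exact this
  let Φ : (Fin (m + b + 1) → ℝ) → (Fin (m + b + 1) → ℝ) := fun w => μc (a0 + T1 w) (b0 + T2 w)
  have hΦ : ContDiff ℝ ω Φ := by
    have h1 : ContDiff ℝ ω (fun w => μc (a0 + T1 w)) :=
      μc.contDiff.comp (contDiff_const.add T1.contDiff)
    exact h1.clm_apply (contDiff_const.add T2.contDiff)
  have hΦ0 : Φ 0 = toFn (m + b + 1) (A0 * B0) := by
    simp only [Φ, map_zero, add_zero, hμc, hμ, a0, b0]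
    rw [ofto _ A0 hA0, ofto _ B0 hB0]
  have hder : HasFDerivAt Φ ((ContinuousLinearEquiv.refl ℝ (Fin (m + b + 1) → ℝ) : _ ≃L[ℝ] _) : _ →L[ℝ] _) 0 := by
    have h1 : HasFDerivAt (fun w => μc (a0 + T1 w)) (μc ∘L T1) 0 :=
      μc.hasFDerivAt.comp _ (T1.hasFDerivAt.const_add a0)
    have h2 : HasFDerivAt (fun w => b0 + T2 w) T2 0 := T2.hasFDerivAt.const_add b0
    have h3 := h1.clm_apply h2
    refine h3.congr_fderiv ?_
    ext1 w
    simp only [map_zero, add_zero]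
    have := hT' w
    exact (add_comm (μ a0 (T2 w)) (μ (T1 w) b0)).trans this
  let Ψ := hΦ.contDiffAt.localInverse hder (by simp)
  have hΨ0 : Ψ (Φ 0) = 0 := ContDiffAt.localInverse_apply_image _ hder _
  have hΨ : ContDiffAt ℝ ω Ψ (Φ 0) := ContDiffAt.to_localInverse _ hder _
  have hinv : ∀ᶠ c in 𝓝 (Φ 0), Φ (Ψ c) = c :=
    (hΦ.contDiffAt.hasStrictFDerivAt' hder (by simp)).eventually_right_inverse
  rw [hΦ0] at hΨ0 hΨ hinv
  refine ⟨fun c => a0 + T1 (Ψ c), fun c => b0 + T2 (Ψ c), ?_, ?_, ?_, ?_, ?_⟩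
  · exact (contDiffAt_const.add (T1.contDiff.contDiffAt.comp _ hΨ)).analyticAt
  · exact (contDiffAt_const.add (T2.contDiff.contDiffAt.comp _ hΨ)).analyticAt
  · simp only [hΨ0, map_zero, add_zero]; exact ofto _ _ hA0
  · simp only [hΨ0, map_zero, add_zero]; exact ofto _ _ hB0
  · filter_upwards [hinv] with c hc
    conv_rhs => rw [← hc]
    simp only [Φ, hμc, hμ]
    rw [ofto]
    refine natDegree_mul_le.trans ?_
    have h1 := ofFn_natDegree_lt (n := m + 1) (by omega) (a0 + T1 (Ψ c))
    have h2 := ofFn_natDegree_lt (n := b + 1) (by omega) (b0 + T2 (Ψ c))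
    omega

theorem aux_res_analytic {E : Type*} [NormedAddCommGroup E] [NormedSpace ℝ E] (m n : ℕ)
    (F G : E → ℝ[X]) (p : E) (hF : ∀ i, AnalyticAt ℝ (fun x => (F x).coeff i) p)
    (hG : ∀ i, AnalyticAt ℝ (fun x => (G x).coeff i) p) :
    AnalyticAt ℝ (fun x => resultant (F x) (G x) m n) p := by
  simp only [← aux_resFixed, resFixed, Matrix.det_apply']
  apply Finset.analyticAt_fun_sum
  intro σ _
  apply AnalyticAt.fun_mul analyticAt_const
  apply Finset.analyticAt_fun_prod
  intro i _
  unfold _root_.sylvester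
  split_ifs
  · exact hF _
  · exact analyticAt_const
  · exact hG _
  · exact analyticAt_const

theorem aux_lift {E : Type*} [TopologicalSpace E] {θ : E → RP1} {S : Set E} {p : E}
    (hθ : ContinuousWithinAt θ S p) (v : Fin 2 → ℝ) (hv : v ≠ 0)
    (hp : θ p = Projectivization.mk ℝ v hv) (N : Set (E × (Fin 2 → ℝ))) (hN : N ∈ 𝓝 (p, v)) :
    ∀ᶠ x in 𝓝[S] p, ∃ (w : Fin 2 → ℝ) (hw : w ≠ 0), θ x = Projectivization.mk ℝ w hw ∧ (x, w) ∈ N := by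
  rw [nhds_prod_eq, mem_prod_iff] at hN
  obtain ⟨U, hU, V, hV, hUV⟩ := hN
  obtain ⟨V', hV'V, hV'o, hvV'⟩ := mem_nhds_iff.1 hV
  let O : Set RP1 := {q | ∃ (w : Fin 2 → ℝ) (hw : w ≠ 0), q = Projectivization.mk ℝ w hw ∧ w ∈ V'}
  have hO : IsOpen O := by
    have hq : IsOpen O ↔ IsOpen ((fun u : {w : Fin 2 → ℝ // w ≠ 0} => Projectivization.mk ℝ u.1 u.2) ⁻¹' O) := Iff.rfl
    rw [hq]
    have : ((fun u : {w : Fin 2 → ℝ // w ≠ 0} => Projectivization.mk ℝ u.1 u.2) ⁻¹' O) =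
        ⋃ a : ℝˣ, {u : {w : Fin 2 → ℝ // w ≠ 0} | a • u.1 ∈ V'} := by
      ext ⟨u, hu⟩
      simp only [Set.mem_preimage, Set.mem_iUnion, O]
      constructor
      · rintro ⟨w, hw, he, hwV⟩
        obtain ⟨a, ha⟩ := (Projectivization.mk_eq_mk_iff ℝ w u hw hu).1 he.symm
        refine ⟨a, ?_⟩
        show a • u ∈ V'
        rw [ha]; exact hwV
      · rintro ⟨a, ha⟩
        have ha : a • u ∈ V' := ha
        have hne : a • u ≠ 0 := (smul_ne_zero_iff_ne a).2 hu
        exact ⟨a • u, hne, ((Projectivization.mk_eq_mk_iff ℝ _ _ hne hu).2 ⟨a, rfl⟩).symm, ha⟩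
    rw [this]
    apply isOpen_iUnion
    intro a
    exact hV'o.preimage (continuous_subtype_val.const_smul a)
  have hpO : θ p ∈ O := ⟨v, hv, hp, hvV'⟩
  filter_upwards [hθ (hO.mem_nhds hpO), mem_nhdsWithin_of_mem_nhds hU] with x hx hxU
  obtain ⟨w, hw, he, hwV⟩ := hx
  exact ⟨w, hw, he, hUV ⟨hxU, hV'V hwV⟩⟩

theorem aux_cont_eval {E : Type*} [TopologicalSpace E] (d : ℕ) (F : E → ℝ[X]) (p : E) (v : Fin 2 → ℝ)
    (hF : ∀ i, ContinuousAt (fun x => (F x).coeff i) p) :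
    ContinuousAt (fun q : E × (Fin 2 → ℝ) => MvPolynomial.eval q.2 (homog d (F q.1))) (p, v) := by
  simp only [aux_eval_homog]
  apply tendsto_finsetSum
  intro k _
  have h1 : ContinuousAt (fun q : E × (Fin 2 → ℝ) => (F q.1).coeff k) (p, v) :=
    ContinuousAt.comp (g := fun x => (F x).coeff k) (hF k) continuousAt_fst
  have h2 : ContinuousAt (fun q : E × (Fin 2 → ℝ) => q.2 0 ^ k) (p, v) := by fun_prop
  have h3 : ContinuousAt (fun q : E × (Fin 2 → ℝ) => q.2 1 ^ (d - k)) (p, v) := by fun_prop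
  exact (h1.mul h2).mul h3

theorem aux_smul_eval (d : ℕ) (P : ℝ[X]) (v w : Fin 2 → ℝ) (hv : v ≠ 0) (hw : w ≠ 0)
    (h : Projectivization.mk ℝ v hv = Projectivization.mk ℝ w hw) :
    MvPolynomial.eval v (homog d P) = 0 ↔ MvPolynomial.eval w (homog d P) = 0 := by
  obtain ⟨a, ha⟩ := (Projectivization.mk_eq_mk_iff ℝ v w hv hw).1 h
  have : MvPolynomial.eval v (homog d P) = (a : ℝ) ^ d * MvPolynomial.eval w (homog d P) := by
    rw [aux_eval_homog, aux_eval_homog, Finset.mul_sum, ← ha]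
    apply Finset.sum_congr rfl
    intro k hk
    have hk : k ≤ d := by simpa [Nat.lt_succ_iff] using hk
    have : (a : ℝ) ^ d = (a : ℝ) ^ k * (a : ℝ) ^ (d - k) := by rw [← pow_add]; congr 1; omega
    rw [this]
    simp [Units.smul_def, mul_pow]
    ring
  rw [this]
  simp
end PartC
section PartD
open Polynomial Filter Topology

theorem aux_coeff_analytic {m : ℕ} (P : Polynomial (MvPolynomial (Fin m) ℝ)) (i : ℕ) (p : Fin m → ℝ) :
    AnalyticAt ℝ (fun x => (evalP P x).coeff i) p := by
  simp only [evalP, coeff_map]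
  exact AnalyticOnNhd.eval_mvPolynomial (P.coeff i) p (Set.mem_univ p)

theorem aux_res_eval {m : ℕ} (pn qn : ℕ) (P Q : Polynomial (MvPolynomial (Fin m) ℝ)) (x : Fin m → ℝ) :
    MvPolynomial.eval x (resFixed pn qn P Q) = resultant (evalP P x) (evalP Q x) pn qn := by
  rw [aux_resFixed, evalP, evalP, resultant_map_map]

theorem aux_ofFn_analytic {E : Type*} [NormedAddCommGroup E] [NormedSpace ℝ E] (n : ℕ)
    (F : E → Fin n → ℝ) (p : E) (hF : AnalyticAt ℝ F p) (i : ℕ) :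
    AnalyticAt ℝ (fun x => (ofFn n (F x)).coeff i) p := by
  by_cases hi : i < n
  · simp only [ofFn_coeff_eq_val_of_lt _ hi]
    exact (analyticAt_pi_iff.1 hF) ⟨i, hi⟩
  · simp only [ofFn_coeff_eq_zero_of_ge _ (not_lt.1 hi)]
    exact analyticAt_const

theorem aux_local {m pn qn : ℕ} (P Q : Polynomial (MvPolynomial (Fin m) ℝ))
    (hPdeg : P.natDegree = pn) (hQdeg : Q.natDegree = qn) (S : Set (Fin m → ℝ))
    (hPnn : ∀ x ∈ S, evalP P x ≠ 0) (hr0 : resFixed pn qn P Q ≠ 0)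
    (hrinv : OrderInvariantOn (fun x => MvPolynomial.eval x (resFixed pn qn P Q)) S)
    (θ : (Fin m → ℝ) → RP1) (hθ : ContinuousOn θ S) (mu : ℕ) (hmu : 0 < mu)
    (hroot : ∀ x ∈ S, ∀ (v : Fin 2 → ℝ) (hv : v ≠ 0),
      θ x = Projectivization.mk ℝ v hv → HasProjRootOfMult (homog pn (evalP P x)) v mu)
    (p : Fin m → ℝ) (hp : p ∈ S) (v : Fin 2 → ℝ) (hv : v ≠ 0) (hpv : θ p = Projectivization.mk ℝ v hv)
    (hV : MvPolynomial.eval v (homog qn (evalP Q p)) = 0) :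
    ∀ᶠ x in 𝓝[S] p, ∃ (w : Fin 2 → ℝ) (hw : w ≠ 0), θ x = Projectivization.mk ℝ w hw ∧
      MvPolynomial.eval w (homog qn (evalP Q x)) = 0 := by
  have hPd : ∀ x, (evalP P x).natDegree ≤ pn := fun x => hPdeg ▸ natDegree_map_le
  have hQd : ∀ x, (evalP Q x).natDegree ≤ qn := fun x => hQdeg ▸ natDegree_map_le
  obtain ⟨hle, h, hh, hPh, hne⟩ := aux_root_struct pn mu _ (hPd p) (hPnn p hp) v (hroot p hp v hv hpv)
  obtain ⟨b, rfl⟩ := Nat.exists_eq_add_of_le hle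
  rw [Nat.add_sub_cancel_left] at hh hne
  have hlin : ((C (v 1) * X - C (v 0)) ^ mu : ℝ[X]).natDegree ≤ mu := by
    refine natDegree_pow_le.trans ?_
    have : (C (v 1) * X - C (v 0) : ℝ[X]).natDegree ≤ 1 := by compute_degree
    nlinarith
  obtain ⟨α, β, hα, hβ, hα0, hβ0, hαβ⟩ := aux_factor mu b _ h hlin hh (aux_surj mu b v hv h hh hne)
  rw [← hPh] at hα hβ hα0 hβ0 hαβ
  let c : (Fin m → ℝ) → (Fin (mu + b + 1) → ℝ) := fun x => toFn (mu + b + 1) (evalP P x)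
  have hc : AnalyticAt ℝ c p := by
    rw [analyticAt_pi_iff]
    intro i
    exact aux_coeff_analytic P i p
  have hofc : ∀ x, ofFn _ (c x) = evalP P x := fun x =>
    ofFn_comp_toFn_eq_id_of_natDegree_lt (Nat.lt_succ_of_le (hPd x))
  let A : (Fin m → ℝ) → ℝ[X] := fun x => ofFn (mu + 1) (α (c x))
  let B : (Fin m → ℝ) → ℝ[X] := fun x => ofFn (b + 1) (β (c x))
  have hAa : ∀ i, AnalyticAt ℝ (fun x => (A x).coeff i) p :=
    aux_ofFn_analytic _ _ p (AnalyticAt.comp (g := α) (f := c) hα hc)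
  have hBa : ∀ i, AnalyticAt ℝ (fun x => (B x).coeff i) p :=
    aux_ofFn_analytic _ _ p (AnalyticAt.comp (g := β) (f := c) hβ hc)
  have hAd : ∀ x, (A x).natDegree ≤ mu := fun x => Nat.lt_succ_iff.1 (ofFn_natDegree_lt (by omega) _)
  have hBd : ∀ x, (B x).natDegree ≤ b := fun x => Nat.lt_succ_iff.1 (ofFn_natDegree_lt (by omega) _)
  have hAB : ∀ᶠ x in 𝓝 p, evalP P x = A x * B x := by
    have h1 := hc.continuousAt.eventually hαβ
    filter_upwards [h1] with x hx
    rw [← hofc x]; exact hx.symm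
  have hQa : ∀ i, AnalyticAt ℝ (fun x => (evalP Q x).coeff i) p := fun i => aux_coeff_analytic Q i p
  have hfa := aux_res_analytic mu qn A (evalP Q) p hAa hQa
  have hga := aux_res_analytic b qn B (evalP Q) p hBa hQa
  have hra : AnalyticAt ℝ (fun x => MvPolynomial.eval x (resFixed (mu + b) qn P Q)) p :=
    AnalyticOnNhd.eval_mvPolynomial _ p (Set.mem_univ p)
  have hA0 : A p = (C (v 1) * X - C (v 0)) ^ mu := hα0
  have hf0 := aux_order hra hfa hga
    (by
      filter_upwards [hAB] with x hx
      rw [aux_res_eval, hx]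
      exact aux_resultant_mul _ _ _ _ _ _ (hAd x) (hBd x) (hQd x))
    (aux_fin _ hr0 p)
    (by
      have := (aux_res_pow 1 one_ne_zero v hv (evalP Q p) mu qn hmu (hQd p)).2 hV
      rw [hA0]
      rw [C_1, one_mul] at this
      exact this) S hp hrinv
  have hBp : B p = h := hβ0
  have hNB : {q : (Fin m → ℝ) × (Fin 2 → ℝ) | MvPolynomial.eval q.2 (homog b (B q.1)) ≠ 0} ∈ 𝓝 (p, v) :=
    (aux_cont_eval b B p v (fun i => (hBa i).continuousAt)).eventually_ne (by simpa [hBp] using hne)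
  filter_upwards [hf0, aux_lift (hθ p hp) v hv hpv _ hNB, mem_nhdsWithin_of_mem_nhds hAB,
    self_mem_nhdsWithin] with x hfx hx hABx hxS
  obtain ⟨w, hw, hxw, hBw⟩ := hx
  refine ⟨w, hw, hxw, ?_⟩
  obtain ⟨-, h', hh', hPh', -⟩ := aux_root_struct _ mu _ (hPd x) (hPnn x hxS) w (hroot x hxS w hw hxw)
  rw [Nat.add_sub_cancel_left] at hh'
  obtain ⟨e, he, hAe⟩ := aux_A_eq mu b (A x) (B x) _ h' w hw (hAd x) (hBd x) (hPnn x hxS) hABx hPh' hh' hBw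
  rw [hAe] at hfx
  exact (aux_res_pow e he w hw (evalP Q x) mu qn hmu (hQd x)).1 hfx

end PartD

/-- Let `S` be a connected analytic submanifold of `ℝ^m` and `P, Q` of
positive degrees `p_n, q_n` in `x_n`, never nullifying on `S`, with `P` projectively
delineable over `S`. If `Res^{p_n,q_n}_{x_n}(P,Q)` is not the zero polynomial and is
order-invariant over `S`, then along each projective `P`-section over `S`, either
`H^{q_n}(Q)` vanishes at every point of the section or at no point of the section. -/
theorem resultant_Q_sign_invariant_on_sections (m pn qn : ℕ)
    (hpn : 0 < pn) (hqn : 0 < qn)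
    (P Q : Polynomial (MvPolynomial (Fin m) ℝ))
    (hPdeg : P.natDegree = pn) (hQdeg : Q.natDegree = qn)
    (S : Set (Fin m → ℝ)) (hsub : IsAnalyticSubmanifold S) (hconn : IsConnected S)
    (hPnn : ∀ x ∈ S, evalP P x ≠ 0) (hQnn : ∀ x ∈ S, evalP Q x ≠ 0)
    (hdel : ProjDelineable pn P S)
    (hr0 : resFixed pn qn P Q ≠ 0)
    (hrinv : OrderInvariantOn (fun x => MvPolynomial.eval x (resFixed pn qn P Q)) S) :
    ∀ (k : ℕ) (θ : Fin k → (Fin m → ℝ) → RP1), IsProjRootFunctions pn P S θ →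
      ∀ l : Fin k,
        (∀ x ∈ S, ∀ (v : Fin 2 → ℝ) (hv : v ≠ 0), θ l x = Projectivization.mk ℝ v hv →
          MvPolynomial.eval v (homog qn (evalP Q x)) = 0) ∨
        (∀ x ∈ S, ∀ (v : Fin 2 → ℝ) (hv : v ≠ 0), θ l x = Projectivization.mk ℝ v hv →
          MvPolynomial.eval v (homog qn (evalP Q x)) ≠ 0) := by
  intro k θ hθ l
  obtain ⟨hcont, -, -, hmult⟩ := hθ
  obtain ⟨mu, hmu, hroot⟩ := hmult l
  have hrep : ∀ x, ∃ (v : Fin 2 → ℝ) (hv : v ≠ 0), θ l x = Projectivization.mk ℝ v hv := fun x =>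
    ⟨(θ l x).rep, (θ l x).rep_nonzero, (θ l x).mk_rep.symm⟩
  let V : (Fin m → ℝ) → Prop := fun x => ∃ (v : Fin 2 → ℝ) (hv : v ≠ 0),
    θ l x = Projectivization.mk ℝ v hv ∧ MvPolynomial.eval v (homog qn (evalP Q x)) = 0
  have hVall : ∀ x, V x → ∀ (v : Fin 2 → ℝ) (hv : v ≠ 0), θ l x = Projectivization.mk ℝ v hv →
      MvPolynomial.eval v (homog qn (evalP Q x)) = 0 := by
    rintro x ⟨w, hw, hxw, h0⟩ v hv hxv
    exact (aux_smul_eval qn _ v w hv hw (hxv.symm.trans hxw)).2 h0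
  have hloc : ∀ p ∈ S, ∀ᶠ x in nhdsWithin p S, (V p ↔ V x) := by
    intro p hp
    by_cases hVp : V p
    · obtain ⟨v, hv, hpv, h0⟩ := hVp
      have := aux_local P Q hPdeg hQdeg S hPnn hr0 hrinv (θ l) (hcont l) mu hmu hroot p hp v hv hpv h0
      filter_upwards [this] with x hx
      exact ⟨fun _ => hx, fun _ => ⟨v, hv, hpv, h0⟩⟩
    · obtain ⟨v, hv, hpv⟩ := hrep p
      have hne : MvPolynomial.eval v (homog qn (evalP Q p)) ≠ 0 := fun h0 => hVp ⟨v, hv, hpv, h0⟩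
      have hN : {q : (Fin m → ℝ) × (Fin 2 → ℝ) |
          MvPolynomial.eval q.2 (homog qn (evalP Q q.1)) ≠ 0} ∈ nhds (p, v) :=
        (aux_cont_eval qn (evalP Q) p v
          (fun i => (aux_coeff_analytic Q i p).continuousAt)).eventually_ne hne
      filter_upwards [aux_lift (hcont l p hp) v hv hpv _ hN] with x hx
      obtain ⟨w, hw, hxw, hwN⟩ := hx
      exact ⟨fun h => absurd h hVp, fun h => absurd (hVall x h w hw hxw) hwN⟩
  have hconst : ∀ x ∈ S, ∀ y ∈ S, (V x ↔ V y) := by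
    intro x hx y hy
    exact hconn.isPreconnected.induction₂ (fun x y => (V x ↔ V y)) hloc
      (fun x y z _ _ _ h1 h2 => h1.trans h2) (fun x y _ _ h => h.symm) hx hy
  obtain ⟨p, hp⟩ := hconn.nonempty
  by_cases hVp : V p
  · left
    exact fun x hx => hVall x ((hconst p hp x hx).1 hVp)
  · right
    intro x hx v hv hxv h0
    exact hVp ((hconst x hx p hp).1 ⟨v, hv, hxv, h0⟩)
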